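/- arXiv:2505.24490 — 2 statements merged into one kernel-verified Lean document; each statement's English description precedes it below -/
import Mathlib

section
/- There exists K such that for every integer k ≥ K, every bipartite outer k-planar graph with a nonempty vertex set has a vertex of degree at most 2·√(8/11)·√k + 2. -/
open scoped Classical

/-- A point in the plane. -/
abbrev Pt := EuclideanSpace ℝ (Fin 2)

/-- A finite point set is in convex position (convexly independent). -/
def ConvexPos (V : Finset Pt) : Prop :=
  ∀ p ∈ V, p ∉ convexHull ℝ ((V.erase p : Finset Pt) : Set Pt)

/-- The open straight-line segment drawn for an unordered pair of points. -/
noncomputable def edgeSeg (e : Sym2 Pt) : Set Pt :=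
  Sym2.lift ⟨fun a b => openSegment ℝ a b, fun a b => openSegment_symm ℝ a b⟩ e

/-- Two distinct edges cross if their open segments intersect. -/
def Cross (e f : Sym2 Pt) : Prop :=
  e ≠ f ∧ (edgeSeg e ∩ edgeSeg f).Nonempty

theorem Cross_comm (e f : Sym2 Pt) : Cross e f ↔ Cross f e := by
  unfold Cross
  rw [Set.inter_comm]
  exact and_congr_left' ne_comm

/-- A convex geometric graph: points in convex position, edges are unordered
pairs of distinct points of `V`. -/
structure ConvexGeomGraph where
  V : Finset Pt
  E : Finset (Sym2 Pt)
  convexPos : ConvexPos V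
  not_diag : ∀ e ∈ E, ¬ e.IsDiag
  mem_V : ∀ e ∈ E, ∀ p ∈ e, p ∈ V

/-- A convex geometric graph is outer `k`-planar if every edge crosses at
most `k` other edges. -/
noncomputable def OuterKPlanar (G : ConvexGeomGraph) (k : ℕ) : Prop :=
  ∀ e ∈ G.E, (G.E.filter (fun f => Cross e f)).card ≤ k

/-- Bipartite: vertices can be partitioned into `A` and `B` with every edge
joining a point of `A` to a point of `B`. -/
def Bipartite (G : ConvexGeomGraph) : Prop :=
  ∃ A B : Finset Pt, A ∪ B = G.V ∧ Disjoint A B ∧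
    ∀ e ∈ G.E, ∃ a ∈ A, ∃ b ∈ B, e = s(a, b)

/-- The degree of a vertex: number of edges containing it. -/
noncomputable def degree (G : ConvexGeomGraph) (v : Pt) : ℕ :=
  (G.E.filter (fun e => v ∈ e)).card

/-- The number of unordered pairs of distinct edges that cross. -/
noncomputable def crossingNumber (E : Finset (Sym2 Pt)) : ℕ :=
  (E.sym2.filter (fun pr => Sym2.lift
    ⟨fun e f => Cross e f, fun e f => propext (Cross_comm e f)⟩ pr)).card

/-- Twice the signed area of the triangle `p q r`. -/
noncomputable def signedArea (p q r : Pt) : ℝ :=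
  (q 0 - p 0) * (r 1 - p 1) - (q 1 - p 1) * (r 0 - p 0)

theorem signedArea_rotate (p q r : Pt) : signedArea q r p = signedArea p q r := by
  unfold signedArea; ring

theorem signedArea_swap (p q r : Pt) : signedArea q p r = -signedArea p q r := by
  unfold signedArea; ring

theorem signedArea_swap_right (p q r : Pt) : signedArea p r q = -signedArea p q r := by
  unfold signedArea; ring

theorem signedArea_add (p q r s : Pt) :
    signedArea p r s + signedArea q p s + signedArea q r p = signedArea q r s := by
  unfold signedArea; ring

theorem Pt.ext_coords {p q : Pt} (h0 : p 0 = q 0) (h1 : p 1 = q 1) : p = q := by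
  ext i
  fin_cases i
  · exact h0
  · exact h1

namespace ConvexPos

variable {V : Finset Pt} {p q r s : Pt}

theorem ne_add_smul_sub (hV : ConvexPos V) (hp : p ∈ V) (hq : q ∈ V) (hr : r ∈ V)
    (hpq : p ≠ q) (hpr : p ≠ r) {c : ℝ} (h0 : 0 ≤ c) (h1 : c ≤ 1) :
    p ≠ q + c • (r - q) := by
  intro h
  refine hV p hp ?_
  have hc := convex_convexHull ℝ ((V.erase p : Finset Pt) : Set Pt)
  have hq' : q ∈ convexHull ℝ ((V.erase p : Finset Pt) : Set Pt) :=
    subset_convexHull _ _ (by simp [hq, hpq.symm])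
  have hr' : r ∈ convexHull ℝ ((V.erase p : Finset Pt) : Set Pt) :=
    subset_convexHull _ _ (by simp [hr, hpr.symm])
  have := hc.add_smul_sub_mem hq' hr' ⟨h0, h1⟩
  rwa [← h] at this

theorem signedArea_ne_zero (hV : ConvexPos V) (hp : p ∈ V) (hq : q ∈ V) (hr : r ∈ V)
    (hpq : p ≠ q) (hpr : p ≠ r) (hqr : q ≠ r) : signedArea p q r ≠ 0 := by
  intro h
  have hpos : 0 < (r 0 - q 0) ^ 2 + (r 1 - q 1) ^ 2 := by
    by_contra hle
    have h0 : r 0 - q 0 = 0 := by nlinarith [sq_nonneg (r 0 - q 0), sq_nonneg (r 1 - q 1)]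
    have h1 : r 1 - q 1 = 0 := by nlinarith [sq_nonneg (r 0 - q 0), sq_nonneg (r 1 - q 1)]
    exact hqr (Pt.ext_coords (by linarith) (by linarith))
  obtain ⟨c, hc⟩ : ∃ c : ℝ, c * ((r 0 - q 0) ^ 2 + (r 1 - q 1) ^ 2) =
      (p 0 - q 0) * (r 0 - q 0) + (p 1 - q 1) * (r 1 - q 1) :=
    ⟨_, div_mul_cancel₀ _ hpos.ne'⟩
  have h' : (p 0 - q 0) * (r 1 - q 1) - (p 1 - q 1) * (r 0 - q 0) = 0 := by
    unfold signedArea at h; linarith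
  have e0 : p 0 = q 0 + c * (r 0 - q 0) := by
    apply mul_right_cancel₀ hpos.ne'
    linear_combination (-(r 0 - q 0)) * hc + (r 1 - q 1) * h'
  have e1 : p 1 = q 1 + c * (r 1 - q 1) := by
    apply mul_right_cancel₀ hpos.ne'
    linear_combination (-(r 1 - q 1)) * hc - (r 0 - q 0) * h'
  rcases lt_or_ge c 0 with hc0 | hc0
  · have hc1 : 0 < 1 - c := by linarith
    refine hV.ne_add_smul_sub (c := -c / (1 - c)) hq hp hr hpq.symm hqr
      (div_nonneg (by linarith) hc1.le) ((div_le_one hc1).2 (by linarith)) ?_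
    refine Pt.ext_coords ?_ ?_ <;> simp [e0, e1] <;> field_simp <;> ring
  rcases le_or_gt c 1 with hc1 | hc1
  · refine hV.ne_add_smul_sub hp hq hr hpq hpr hc0 hc1 ?_
    exact Pt.ext_coords (by simp [e0]) (by simp [e1])
  · refine hV.ne_add_smul_sub (c := 1 / c) hr hq hp hqr.symm hpr.symm
      (by positivity) ((div_le_one (by linarith)).2 hc1.le) ?_
    have : c ≠ 0 := by linarith
    refine Pt.ext_coords ?_ ?_ <;> simp [e0, e1] <;> field_simp <;> ring

/-- No point of a set in convex position lies inside a triangle of three others. -/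
theorem not_mem_triangle (hV : ConvexPos V) (hp : p ∈ V) (hq : q ∈ V) (hr : r ∈ V) (hs : s ∈ V)
    (h1 : 0 < signedArea p r s) (h2 : 0 < signedArea q p s) (h3 : 0 < signedArea q r p) :
    False := by
  have hpq : q ≠ p := by rintro rfl; simp [signedArea] at h2
  have hpr : r ≠ p := by rintro rfl; simp [signedArea] at h1
  have hps : s ≠ p := by rintro rfl; unfold signedArea at h1; linarith
  have hsum := signedArea_add p q r s
  have hpos : 0 < signedArea q r s := by linarith
  refine hV p hp ?_
  have hmem : ∀ x ∈ V, x ≠ p → x ∈ convexHull ℝ ((V.erase p : Finset Pt) : Set Pt) :=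
    fun x hx hxp => subset_convexHull _ _ (by simp [hx, hxp])
  have key := (convex_convexHull ℝ ((V.erase p : Finset Pt) : Set Pt)).sum_mem
    (t := Finset.univ)
    (w := ![signedArea p r s / signedArea q r s, signedArea q p s / signedArea q r s,
      signedArea q r p / signedArea q r s]) (z := ![q, r, s])
    (by intro i _; fin_cases i <;> simp <;> positivity)
    (by simp [Fin.sum_univ_three]; field_simp; exact hsum)
    (by intro i _; fin_cases i
        exacts [hmem q hq hpq, hmem r hr hpr, hmem s hs hps])
  convert key using 1
  refine Pt.ext_coords ?_ ?_ <;> simp [Fin.sum_univ_three] <;> field_simp <;>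
    unfold signedArea <;> ring

end ConvexPos

/-- Segments joining points of a set in convex position meet as soon as the endpoints of one lie
on different sides of the other. -/
theorem ConvexPos.cross {V : Finset Pt} (hV : ConvexPos V) {a b x y : Pt} (ha : a ∈ V)
    (hb : b ∈ V) (hx : x ∈ V) (hy : y ∈ V) (h1 : 0 < signedArea a b x)
    (h2 : 0 < signedArea b a y) : Cross s(a, b) s(x, y) := by
  have hxa : x ≠ a := by rintro rfl; unfold signedArea at h1; linarith
  have hxb : x ≠ b := by rintro rfl; unfold signedArea at h1; linarith
  have hya : y ≠ a := by rintro rfl; unfold signedArea at h2; linarith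
  have hyb : y ≠ b := by rintro rfl; unfold signedArea at h2; linarith
  have hxy : x ≠ y := by rintro rfl; rw [signedArea_swap] at h2; linarith
  have hna := hV.signedArea_ne_zero hx hy ha hxy hxa hya
  have hnb := hV.signedArea_ne_zero hx hy hb hxy hxb hyb
  have ea : signedArea a x y = signedArea x y a := (signedArea_rotate a x y).symm
  have eb : signedArea b x y = signedArea x y b := (signedArea_rotate b x y).symm
  have hlt : signedArea x y a < signedArea x y b := by
    have : signedArea x y b - signedArea x y a = signedArea a b x + signedArea b a y := by
      unfold signedArea; ring
    linarith
  have hA : signedArea x y a < 0 := by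
    refine lt_of_le_of_ne (not_lt.1 fun hA => ?_) hna
    exact hV.not_mem_triangle ha hb hx hy (by linarith) h2 (by rwa [signedArea_rotate])
  have hB : 0 < signedArea x y b := by
    refine lt_of_le_of_ne (not_lt.1 fun hB => ?_) hnb.symm
    exact hV.not_mem_triangle hb ha hy hx (by rw [signedArea_swap_right]; linarith) h1
      (by rwa [signedArea_rotate])
  refine ⟨fun h => ?_, ?_⟩
  · rcases Sym2.eq_iff.1 h with h | h
    · exact hxa h.1.symm
    · exact hxb h.2.symm
  · have d1 : 0 < signedArea x y b - signedArea x y a := by linarith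
    have d2 : 0 < signedArea a b x + signedArea b a y := by linarith
    refine ⟨(signedArea x y b / (signedArea x y b - signedArea x y a)) • a +
      (-signedArea x y a / (signedArea x y b - signedArea x y a)) • b, ?_, ?_⟩
    · exact ⟨_, _, div_pos hB d1, div_pos (by linarith) d1, by field_simp; ring, rfl⟩
    · refine ⟨signedArea b a y / (signedArea a b x + signedArea b a y),
        signedArea a b x / (signedArea a b x + signedArea b a y),
        div_pos h2 d2, div_pos h1 d2, by field_simp; ring, ?_⟩
      refine Pt.ext_coords ?_ ?_ <;> simp <;> field_simp <;> unfold signedArea <;> ring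

/-- The points of `V` strictly to the left of the line from `a` to `b`. -/
noncomputable def leftSide (V : Finset Pt) (a b : Pt) : Finset Pt :=
  V.filter fun z => 0 < signedArea a b z

theorem mem_leftSide {V : Finset Pt} {a b z : Pt} :
    z ∈ leftSide V a b ↔ z ∈ V ∧ 0 < signedArea a b z := by
  simp [leftSide]

theorem ne_left_of_mem_leftSide {V : Finset Pt} {a b z : Pt} (h : z ∈ leftSide V a b) :
    z ≠ a := by
  rintro rfl
  have := (mem_leftSide.1 h).2
  unfold signedArea at this
  linarith

theorem ne_right_of_mem_leftSide {V : Finset Pt} {a b z : Pt} (h : z ∈ leftSide V a b) :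
    z ≠ b := by
  rintro rfl
  have := (mem_leftSide.1 h).2
  unfold signedArea at this
  linarith

theorem notMem_leftSide_swap {V : Finset Pt} {a b z : Pt} (h : z ∈ leftSide V a b) :
    z ∉ leftSide V b a := by
  intro h'
  have h1 := (mem_leftSide.1 h).2
  have h2 := (mem_leftSide.1 h').2
  rw [signedArea_swap] at h2
  linarith

namespace ConvexPos

variable {V : Finset Pt} {a b y z : Pt}

theorem mem_leftSide_or (hV : ConvexPos V) (ha : a ∈ V) (hb : b ∈ V) (hz : z ∈ V)
    (hab : a ≠ b) (hza : z ≠ a) (hzb : z ≠ b) : z ∈ leftSide V a b ∨ z ∈ leftSide V b a := by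
  simp only [mem_leftSide, hz, true_and, signedArea_swap a b]
  rcases lt_or_gt_of_ne (hV.signedArea_ne_zero ha hb hz hab hza.symm hzb.symm) with h | h
  · right; linarith
  · exact Or.inl h

theorem leftSide_subset_left (hV : ConvexPos V) (ha : a ∈ V) (hb : b ∈ V)
    (hab : a ≠ b) (hy : y ∈ leftSide V a b) : leftSide V a y ⊆ leftSide V a b := by
  intro z hz
  have hza := ne_left_of_mem_leftSide hz
  obtain ⟨hyV, hy'⟩ := mem_leftSide.1 hy
  obtain ⟨hzV, hz'⟩ := mem_leftSide.1 hz
  have hzb : z ≠ b := by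
    rintro rfl
    rw [signedArea_swap_right] at hz'
    linarith
  refine (hV.mem_leftSide_or ha hb hzV hab hza hzb).resolve_right fun h => ?_
  exact hV.not_mem_triangle ha hb hyV hzV hz' (mem_leftSide.1 h).2 (by rwa [signedArea_rotate])

theorem leftSide_subset_right (hV : ConvexPos V) (ha : a ∈ V) (hb : b ∈ V)
    (hab : a ≠ b) (hy : y ∈ leftSide V a b) : leftSide V y b ⊆ leftSide V a b := by
  intro z hz
  have hzb := ne_right_of_mem_leftSide hz
  obtain ⟨hyV, hy'⟩ := mem_leftSide.1 hy
  obtain ⟨hzV, hz'⟩ := mem_leftSide.1 hz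
  have hza : z ≠ a := by
    rintro rfl
    rw [← signedArea_rotate, signedArea_swap_right, signedArea_rotate,
      ← signedArea_rotate] at hz'
    rw [← signedArea_rotate] at hy'
    linarith
  refine (hV.mem_leftSide_or ha hb hzV hab hza hzb).resolve_right fun h => ?_
  exact hV.not_mem_triangle hb hyV ha hzV (mem_leftSide.1 h).2 hz'
    (by rwa [signedArea_rotate, signedArea_rotate])

theorem leftSide_subset_union (hV : ConvexPos V) (ha : a ∈ V) (hb : b ∈ V)
    (hy : y ∈ leftSide V a b) :
    leftSide V a b ⊆ insert y (leftSide V a y ∪ leftSide V y b) := by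
  intro z hz
  obtain ⟨hyV, hy'⟩ := mem_leftSide.1 hy
  obtain ⟨hzV, hz'⟩ := mem_leftSide.1 hz
  by_contra hcon
  simp only [Finset.mem_insert, Finset.mem_union, not_or] at hcon
  have h1 := (hV.mem_leftSide_or ha hyV hzV (ne_left_of_mem_leftSide hy).symm
    (ne_left_of_mem_leftSide hz) hcon.1).resolve_left hcon.2.1
  have h2 := (hV.mem_leftSide_or hyV hb hzV (ne_right_of_mem_leftSide hy)
    hcon.1 (ne_right_of_mem_leftSide hz)).resolve_left hcon.2.2
  have h1' := (mem_leftSide.1 h1).2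
  have h2' := (mem_leftSide.1 h2).2
  refine hV.not_mem_triangle hzV ha hb hyV ?_ ?_ hz'
  · rwa [← signedArea_rotate]
  · rwa [← signedArea_rotate, ← signedArea_rotate]

theorem card_leftSide_le (hV : ConvexPos V) (ha : a ∈ V) (hb : b ∈ V)
    (hy : y ∈ leftSide V a b) :
    (leftSide V a b).card ≤ (leftSide V a y).card + (leftSide V y b).card + 1 :=
  (Finset.card_le_card (hV.leftSide_subset_union ha hb hy)).trans <|
    (Finset.card_insert_le _ _).trans (Nat.add_le_add_right (Finset.card_union_le _ _) 1)

theorem card_leftSide_lt_left (hV : ConvexPos V) (ha : a ∈ V) (hb : b ∈ V)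
    (hab : a ≠ b) (hy : y ∈ leftSide V a b) :
    (leftSide V a y).card < (leftSide V a b).card :=
  Finset.card_lt_card <| (Finset.ssubset_iff_of_subset (hV.leftSide_subset_left ha hb hab hy)).2
    ⟨y, hy, fun h => ne_right_of_mem_leftSide h rfl⟩

theorem card_leftSide_lt_right (hV : ConvexPos V) (ha : a ∈ V) (hb : b ∈ V)
    (hab : a ≠ b) (hy : y ∈ leftSide V a b) :
    (leftSide V y b).card < (leftSide V a b).card :=
  Finset.card_lt_card <| (Finset.ssubset_iff_of_subset (hV.leftSide_subset_right ha hb hab hy)).2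
    ⟨y, hy, fun h => ne_left_of_mem_leftSide h rfl⟩

end ConvexPos

/-- The neighbours of `x` in `G`. -/
noncomputable def neighbors (G : ConvexGeomGraph) (x : Pt) : Finset Pt :=
  G.V.filter fun y => s(x, y) ∈ G.E

theorem mem_neighbors {G : ConvexGeomGraph} {x y : Pt} :
    y ∈ neighbors G x ↔ s(x, y) ∈ G.E := by
  simp only [neighbors, Finset.mem_filter, and_iff_right_iff_imp]
  exact fun h => G.mem_V _ h y (Sym2.mem_mk_right x y)

theorem degree_eq_card_neighbors (G : ConvexGeomGraph) (x : Pt) :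
    degree G x = (neighbors G x).card := by
  rw [degree, ← Finset.card_image_of_injective (neighbors G x) (f := fun y => s(x, y))
    fun y z h => Sym2.congr_right.1 h]
  congr 1
  ext e
  simp only [Finset.mem_filter, Finset.mem_image, mem_neighbors]
  constructor
  · rintro ⟨he, y, rfl⟩
    exact ⟨y, he, rfl⟩
  · rintro ⟨y, hy, rfl⟩
    exact ⟨hy, Sym2.mem_mk_left x y⟩

/-- The ordered pairs in `S × U` that are joined by an edge of `G`. -/
noncomputable def adjPairs (G : ConvexGeomGraph) (S U : Finset Pt) : Finset (Pt × Pt) :=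
  (S ×ˢ U).filter fun p => s(p.1, p.2) ∈ G.E

theorem mem_adjPairs {G : ConvexGeomGraph} {S U : Finset Pt} {p : Pt × Pt} :
    p ∈ adjPairs G S U ↔ (p.1 ∈ S ∧ p.2 ∈ U) ∧ s(p.1, p.2) ∈ G.E := by
  simp [adjPairs]

theorem card_adjPairs (G : ConvexGeomGraph) (S U : Finset Pt) :
    (adjPairs G S U).card = ∑ x ∈ S, (U.filter fun y => s(x, y) ∈ G.E).card := by
  simp only [adjPairs, Finset.card_filter, Finset.sum_product]

theorem OuterKPlanar.card_adjPairs_leftSide_le {G : ConvexGeomGraph} {k : ℕ}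
    (hG : OuterKPlanar G k) {a b : Pt} (hab : s(a, b) ∈ G.E) :
    (adjPairs G (leftSide G.V a b) (leftSide G.V b a)).card ≤ k := by
  refine le_trans ?_ (hG _ hab)
  refine Finset.card_le_card_of_injOn (fun p => s(p.1, p.2)) ?_ ?_
  · intro p hp
    obtain ⟨⟨h1, h2⟩, h⟩ := mem_adjPairs.1 hp
    simp only [Finset.coe_filter, Set.mem_ofPred_eq]
    exact ⟨h, G.convexPos.cross (G.mem_V _ hab a (Sym2.mem_mk_left a b))
      (G.mem_V _ hab b (Sym2.mem_mk_right a b)) (mem_leftSide.1 h1).1 (mem_leftSide.1 h2).1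
      (mem_leftSide.1 h1).2 (mem_leftSide.1 h2).2⟩
  · intro p hp q hq hpq
    obtain ⟨⟨h1, h2⟩, -⟩ := mem_adjPairs.1 hp
    obtain ⟨⟨h3, h4⟩, -⟩ := mem_adjPairs.1 hq
    rcases Sym2.eq_iff.1 hpq with h | h
    · exact Prod.ext h.1 h.2
    · rw [h.1] at h1
      exact absurd h4 (notMem_leftSide_swap h1)

theorem OuterKPlanar.sum_degree_leftSide_le {G : ConvexGeomGraph} {k : ℕ}
    (hG : OuterKPlanar G k) {a b : Pt} (hab : s(a, b) ∈ G.E) :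
    ∑ x ∈ leftSide G.V a b, degree G x ≤
      (adjPairs G (leftSide G.V a b) (leftSide G.V a b)).card +
        2 * (leftSide G.V a b).card + k := by
  have ha := G.mem_V _ hab a (Sym2.mem_mk_left a b)
  have hb := G.mem_V _ hab b (Sym2.mem_mk_right a b)
  have hne : a ≠ b := fun h => G.not_diag _ hab (Sym2.mk_isDiag_iff.2 h)
  refine le_trans ?_ (Nat.add_le_add_left (hG.card_adjPairs_leftSide_le hab) _)
  rw [card_adjPairs, card_adjPairs, mul_comm, ← smul_eq_mul, ← Finset.sum_const,
    ← Finset.sum_add_distrib, ← Finset.sum_add_distrib]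
  refine Finset.sum_le_sum fun x hx => ?_
  rw [degree_eq_card_neighbors]
  have hsub : neighbors G x ⊆ ((leftSide G.V a b).filter (fun y => s(x, y) ∈ G.E) ∪ {a, b}) ∪
      (leftSide G.V b a).filter (fun y => s(x, y) ∈ G.E) := by
    intro y hy
    have hy' := mem_neighbors.1 hy
    simp only [Finset.mem_union, Finset.mem_filter, hy', and_true, Finset.mem_insert,
      Finset.mem_singleton]
    have := G.convexPos.mem_leftSide_or ha hb (G.mem_V _ hy' y (Sym2.mem_mk_right x y)) hne
    tauto
  refine (Finset.card_le_card hsub).trans ((Finset.card_union_le _ _).trans ?_)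
  gcongr
  refine (Finset.card_union_le _ _).trans ?_
  gcongr
  exact Finset.card_le_two

theorem Bipartite.two_mul_card_adjPairs_le {G : ConvexGeomGraph} (hG : Bipartite G)
    (S : Finset Pt) : 2 * (adjPairs G S S).card ≤ S.card ^ 2 := by
  obtain ⟨A, B, hAB, hdisj, hE⟩ := hG
  have hsub : adjPairs G S S ⊆
      (S.filter (· ∈ A)) ×ˢ (S.filter (· ∉ A)) ∪ (S.filter (· ∉ A)) ×ˢ (S.filter (· ∈ A)) := by
    rintro ⟨x, y⟩ hp
    obtain ⟨⟨hx, hy⟩, h⟩ := mem_adjPairs.1 hp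
    obtain ⟨u, hu, v, hv, huv⟩ := hE _ h
    have hv' : v ∉ A := fun hvA => Finset.disjoint_left.1 hdisj hvA hv
    simp only at hx hy
    rcases Sym2.eq_iff.1 huv with ⟨h1, h2⟩ | ⟨h1, h2⟩ <;> simp only at h1 h2 <;> subst h1 h2 <;>
      simp [*]
  have hle := (Finset.card_le_card hsub).trans (Finset.card_union_le _ _)
  rw [Finset.card_product, Finset.card_product] at hle
  have hsum := Finset.card_filter_add_card_filter_not (s := S) (· ∈ A)
  rw [← hsum]
  zify at hle ⊢
  nlinarith [sq_nonneg (((S.filter (· ∈ A)).card : ℤ) - (S.filter (· ∉ A)).card)]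

/-- If edges of `G` inside the left side of `a b` are short, that side spans few edges. -/
theorem card_adjPairs_leftSide_self_le {G : ConvexGeomGraph} {a b : Pt} {T : ℕ}
    (ha : a ∈ G.V) (hb : b ∈ G.V) (hab : a ≠ b)
    (hT : ∀ x y, s(x, y) ∈ G.E → (leftSide G.V x y).card < (leftSide G.V a b).card →
      (leftSide G.V x y).card < T) :
    (adjPairs G (leftSide G.V a b) (leftSide G.V a b)).card ≤
      2 * ∑ j ∈ Finset.range (leftSide G.V a b).card, min j T := by
  have hV := G.convexPos
  set S := leftSide G.V a b
  have hSV : ∀ x ∈ S, x ∈ G.V ∧ a ≠ x := fun x hx =>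
    ⟨(mem_leftSide.1 hx).1, (ne_left_of_mem_leftSide hx).symm⟩
  set rank : Pt → ℕ := fun x => (leftSide G.V a x).card with hrank
  have htri : ∀ x ∈ S, ∀ y ∈ S, x ≠ y → x ∈ leftSide G.V a y ∨ y ∈ leftSide G.V a x := by
    intro x hx y hy hxy
    refine (hV.mem_leftSide_or ha (hSV y hy).1 (hSV x hx).1 (hSV y hy).2 (hSV x hx).2.symm
      hxy).imp_right fun h => mem_leftSide.2 ⟨(hSV y hy).1, ?_⟩
    rw [signedArea_rotate]
    exact (mem_leftSide.1 h).2
  have hlt : ∀ x ∈ S, ∀ y ∈ leftSide G.V a x, rank y < rank x := fun x hx y hy =>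
    hV.card_leftSide_lt_left ha (hSV x hx).1 (hSV x hx).2 hy
  have hinj : Set.InjOn rank S := by
    intro x hx y hy hxy
    by_contra hne
    rcases htri x hx y hy hne with h | h
    · exact (hlt y hy x h).ne hxy
    · exact (hlt x hx y h).ne' hxy
  have hlow : ∀ x ∈ S, (S.filter fun y => s(x, y) ∈ G.E ∧ rank y < rank x).card ≤
      min (rank x) T := by
    intro x hx
    have : min (rank x) T = (Finset.Ico (rank x - T) (rank x)).card := by
      rw [Nat.card_Ico]; omega
    rw [this]
    refine Finset.card_le_card_of_injOn rank ?_ (hinj.mono fun y hy => (Finset.mem_filter.1 hy).1)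
    intro y hy
    obtain ⟨hyS, hxy, hr⟩ := Finset.mem_filter.1 hy
    have hne : x ≠ y := by rintro rfl; exact hr.ne rfl
    have hyx : y ∈ leftSide G.V a x :=
      (htri x hx y hyS hne).resolve_left fun h => (hlt y hyS x h).not_gt hr
    have h1 := hV.card_leftSide_le ha (hSV x hx).1 hyx
    have h2 := hV.card_leftSide_lt_right ha (hSV x hx).1 (hSV x hx).2 hyx
    have h3 := hV.card_leftSide_lt_left ha hb hab hx
    have h4 := hT y x (by rwa [Sym2.eq_swap]) (h2.trans h3)
    simp only [Finset.coe_Ico, Set.mem_Ico, hrank] at hr ⊢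
    omega
  have hsum : ((adjPairs G S S).filter fun p => rank p.2 < rank p.1).card ≤
      ∑ j ∈ Finset.range S.card, min j T := by
    calc ((adjPairs G S S).filter fun p => rank p.2 < rank p.1).card
        = ∑ x ∈ S, (S.filter fun y => s(x, y) ∈ G.E ∧ rank y < rank x).card := by
          simp only [adjPairs, Finset.filter_filter]
          simp only [Finset.card_filter, Finset.sum_product]
      _ ≤ ∑ x ∈ S, min (rank x) T := Finset.sum_le_sum hlow
      _ = ∑ j ∈ S.image rank, min j T := (Finset.sum_image (f := fun j => min j T) hinj).symm
      _ ≤ _ := by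
          refine Finset.sum_le_sum_of_subset ?_
          intro j hj
          obtain ⟨x, hx, rfl⟩ := Finset.mem_image.1 hj
          exact Finset.mem_range.2 (hV.card_leftSide_lt_left ha hb hab hx)
  have hswap : ((adjPairs G S S).filter fun p => ¬ rank p.2 < rank p.1).card ≤
      ((adjPairs G S S).filter fun p => rank p.2 < rank p.1).card := by
    refine Finset.card_le_card_of_injOn Prod.swap ?_ Prod.swap_injective.injOn
    intro p hp
    obtain ⟨hp, hr⟩ := Finset.mem_filter.1 hp
    obtain ⟨⟨h1, h2⟩, h⟩ := mem_adjPairs.1 hp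
    have hne : rank p.1 ≠ rank p.2 := fun heq =>
      G.not_diag _ h (Sym2.mk_isDiag_iff.2 (hinj h1 h2 heq))
    refine Finset.mem_coe.2 (Finset.mem_filter.2 ⟨mem_adjPairs.2 ⟨⟨h2, h1⟩, ?_⟩, ?_⟩)
    · rwa [Prod.fst_swap, Prod.snd_swap, Sym2.eq_swap]
    · rw [Prod.fst_swap, Prod.snd_swap]
      omega
  have := Finset.card_filter_add_card_filter_not (s := adjPairs G S S)
    (fun p => rank p.2 < rank p.1)
  omega

theorem two_mul_sum_range_min {s T : ℕ} (h : T ≤ s) :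
    2 * ∑ j ∈ Finset.range s, min j T + T * (T + 1) = 2 * s * T := by
  induction s, h using Nat.le_induction with
  | base =>
    have h1 : ∑ j ∈ Finset.range T, min j T = ∑ j ∈ Finset.range T, j :=
      Finset.sum_congr rfl fun j hj => min_eq_left (Finset.mem_range.1 hj).le
    have h2 := Finset.sum_range_id_mul_two T
    rw [h1]
    cases T with
    | zero => simp
    | succ n =>
      rw [Nat.add_sub_cancel] at h2
      linarith
  | succ n hn ih =>
    rw [Finset.sum_range_succ, min_eq_right hn]
    linarith

/-- Some edge has many points on its left when all degrees are large. -/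
theorem exists_le_card_leftSide {G : ConvexGeomGraph} {v : Pt} (hv : v ∈ G.V) {T : ℕ}
    (hd : 2 * T + 1 ≤ degree G v) : ∃ a b, s(a, b) ∈ G.E ∧ T ≤ (leftSide G.V a b).card := by
  rw [degree_eq_card_neighbors] at hd
  obtain ⟨u, hu⟩ := Finset.card_pos.1 (by omega : 0 < (neighbors G v).card)
  have hvu := mem_neighbors.1 hu
  have hne : v ≠ u := fun h => G.not_diag _ hvu (Sym2.mk_isDiag_iff.2 h)
  have huV := G.mem_V _ hvu u (Sym2.mem_mk_right v u)
  have hsub : (neighbors G v).erase u ⊆ leftSide G.V v u ∪ leftSide G.V u v := by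
    intro z hz
    obtain ⟨hzu, hz⟩ := Finset.mem_erase.1 hz
    have hvz := mem_neighbors.1 hz
    refine Finset.mem_union.2 (G.convexPos.mem_leftSide_or hv huV
      (G.mem_V _ hvz z (Sym2.mem_mk_right v z)) hne ?_ hzu)
    rintro rfl
    exact G.not_diag _ hvz (Sym2.mk_isDiag_iff.2 rfl)
  have hle := (Finset.card_le_card hsub).trans (Finset.card_union_le _ _)
  rw [Finset.card_erase_of_mem hu] at hle
  rcases le_or_gt T (leftSide G.V v u).card with h | h
  · exact ⟨v, u, hvu, h⟩
  · exact ⟨u, v, by rwa [Sym2.eq_swap], by omega⟩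

/-- An edge minimising the number of points on its left among those with at least `T` such
points. -/
theorem exists_minimal_leftSide {G : ConvexGeomGraph} {T : ℕ}
    (h : ∃ a b, s(a, b) ∈ G.E ∧ T ≤ (leftSide G.V a b).card) :
    ∃ a b, s(a, b) ∈ G.E ∧ T ≤ (leftSide G.V a b).card ∧
      ∀ x y, s(x, y) ∈ G.E → (leftSide G.V x y).card < (leftSide G.V a b).card →
        (leftSide G.V x y).card < T := by
  have h' : ∃ n, ∃ a b, s(a, b) ∈ G.E ∧ T ≤ n ∧ (leftSide G.V a b).card = n := by
    obtain ⟨a, b, h1, h2⟩ := h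
    exact ⟨_, a, b, h1, h2, rfl⟩
  obtain ⟨a, b, h1, h2, h3⟩ := Nat.find_spec h'
  refine ⟨a, b, h1, h3 ▸ h2, fun x y hxy hlt => ?_⟩
  by_contra hT
  rw [h3] at hlt
  exact Nat.find_min h' hlt ⟨x, y, hxy, not_lt.1 hT, rfl⟩

theorem OuterKPlanar.lower_bound_of_le_degree {G : ConvexGeomGraph} {k d : ℕ}
    (hG : OuterKPlanar G k) (hbip : Bipartite G) (hV : G.V.Nonempty) (hd : 2000 ≤ d)
    (hdeg : ∀ v ∈ G.V, d ≤ degree G v) : 11 * (d : ℝ) ^ 2 ≤ 32 * k := by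
  obtain ⟨v, hv⟩ := hV
  obtain ⟨T, hT1, hT2⟩ : ∃ T : ℕ, 20 * T ≤ 9 * d ∧ 9 * d < 20 * T + 20 :=
    ⟨9 * d / 20, by omega, by omega⟩
  obtain ⟨a, b, hab, hTs, hmin⟩ := exists_minimal_leftSide
    (exists_le_card_leftSide hv (by have := hdeg v hv; omega : 2 * T + 1 ≤ degree G v))
  have ha := G.mem_V _ hab a (Sym2.mem_mk_left a b)
  have hb := G.mem_V _ hab b (Sym2.mem_mk_right a b)
  have hne : a ≠ b := fun h => G.not_diag _ hab (Sym2.mk_isDiag_iff.2 h)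
  have h1 := hG.sum_degree_leftSide_le hab
  have h2 := hbip.two_mul_card_adjPairs_le (leftSide G.V a b)
  have h3 := card_adjPairs_leftSide_self_le ha hb hne hmin
  have h4 := two_mul_sum_range_min hTs
  have h5 : (leftSide G.V a b).card * d ≤ ∑ x ∈ leftSide G.V a b, degree G x := by
    rw [← smul_eq_mul]
    exact Finset.card_nsmul_le_sum _ _ _ fun x hx => hdeg x (mem_leftSide.1 hx).1
  generalize (leftSide G.V a b).card = s at *
  generalize (adjPairs G (leftSide G.V a b) (leftSide G.V a b)).card = P at *
  have h6 : s * d ≤ P + 2 * s + k := h5.trans h1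
  have h7 : P + T * (T + 1) ≤ 2 * s * T := by omega
  have e2 : 2 * (P : ℝ) ≤ (s : ℝ) ^ 2 := by exact_mod_cast h2
  have e6 : (s : ℝ) * d ≤ P + 2 * s + k := by exact_mod_cast h6
  have e7 : (P : ℝ) + T * (T + 1) ≤ 2 * s * T := by exact_mod_cast h7
  have eT1 : 20 * (T : ℝ) ≤ 9 * d := by exact_mod_cast hT1
  have eT2 : 9 * (d : ℝ) < 20 * T + 20 := by exact_mod_cast hT2
  have eTs : (T : ℝ) ≤ s := by exact_mod_cast hTs
  have ed : (2000 : ℝ) ≤ d := by exact_mod_cast hd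
  rcases le_or_gt (2 * (s : ℝ)) (3 * d) with hs | hs
  · have : 0 ≤ (s - (9 * d / 20 - 1)) * (3 * d / 2 - s : ℝ) :=
      mul_nonneg (by linarith) (by linarith)
    nlinarith
  · have q1 : 0 ≤ (s : ℝ) * (9 * d - 20 * T) := mul_nonneg (by linarith) (by linarith)
    have q2 : (9 * d / 20 - 1 : ℝ) ^ 2 ≤ T ^ 2 := by
      apply pow_le_pow_left₀ <;> linarith
    have q3 : 0 ≤ (s - 3 * d / 2 : ℝ) * (d / 10 - 2) := mul_nonneg (by linarith) (by linarith)
    nlinarith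

/-- there is K such that for all k ≥ K every nonempty bipartite
outer k-planar graph has a vertex of degree at most 2·√(8/11)·√k + 2. -/
theorem stmt17 :
    ∃ K : ℕ, ∀ k : ℕ, K ≤ k → ∀ G : ConvexGeomGraph, OuterKPlanar G k →
      Bipartite G → G.V.Nonempty →
      ∃ v ∈ G.V, (degree G v : ℝ) ≤ 2 * Real.sqrt (8 / 11) * Real.sqrt k + 2 := by
  refine ⟨2000 ^ 2, fun k hk G hG hbip hV => ?_⟩
  by_contra! hcon
  obtain ⟨v, hv, hmin⟩ := G.V.exists_min_image (degree G) hV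
  have hd := hcon v hv
  set r := 2 * Real.sqrt (8 / 11) * Real.sqrt k with hr
  have hr0 : 0 ≤ r := by positivity
  have hsq : r ^ 2 = 32 / 11 * k := by
    rw [hr, mul_pow, mul_pow, Real.sq_sqrt (by norm_num), Real.sq_sqrt (by positivity)]
    ring
  have hk' : (2000 : ℝ) ^ 2 ≤ k := by exact_mod_cast hk
  have hr1 : 2000 ≤ r := by
    by_contra! h
    nlinarith
  have hd' : 2000 ≤ degree G v := by
    have : (2000 : ℝ) ≤ degree G v := by linarith
    exact_mod_cast this
  have := hG.lower_bound_of_le_degree hbip hV hd' hmin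
  nlinarith
end

section
/- There exists K such that for every integer k ≥ K, every bipartite outer k-planar graph on n vertices has at most 2·√(8/11)·√k·n edges (approximately 1.7·√k·n). -/
open scoped Classical

section Combinatorics

variable {α : Type*} [LinearOrder α]

/-- The pairs of `E` which, viewed as chords between points listed in cyclic order, cross `e`. -/
noncomputable def interleaving (E : Finset (α × α)) (e : α × α) : Finset (α × α) :=
  E.filter fun f => (e.1 < f.1 ∧ f.1 < e.2 ∧ e.2 < f.2) ∨ (f.1 < e.1 ∧ e.1 < f.2 ∧ f.2 < e.2)

/-- The number of points of `V` in the half-open interval `(e.1, e.2]`. -/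
noncomputable def gap (V : Finset α) (e : α × α) : ℕ :=
  (V.filter fun x => e.1 < x ∧ x ≤ e.2).card

theorem card_filter_gap_le (V T : Finset α) (a : α) (s : ℝ) (hs : 0 ≤ s)
    (hT : ∀ b ∈ T, b ∈ V ∧ a < b ∧ (gap V (a, b) : ℝ) ≤ s) : (T.card : ℝ) ≤ s := by
  rcases T.eq_empty_or_nonempty with rfl | hne
  · simpa using hs
  · refine le_trans ?_ (hT _ (T.max'_mem hne)).2.2
    refine Nat.cast_le.2 (Finset.card_le_card fun b hb => ?_)
    exact Finset.mem_filter.2 ⟨(hT b hb).1, (hT b hb).2.1, T.le_max' b hb⟩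

/-- Pairs of gap at most `s` with left endpoints in `W` number at most `s` per left endpoint. -/
theorem card_le_mul_of_gap_le (V W : Finset α) (F : Finset (α × α)) (s : ℝ) (hs : 0 ≤ s)
    (hF : ∀ f ∈ F, f.1 ∈ W ∧ f.2 ∈ V ∧ f.1 < f.2 ∧ (gap V f : ℝ) ≤ s) :
    (F.card : ℝ) ≤ s * W.card := by
  rw [Finset.card_eq_sum_card_fiberwise (f := Prod.fst) (t := W) fun f hf => (hF f hf).1]
  push_cast
  rw [mul_comm, ← nsmul_eq_mul]
  refine Finset.sum_le_card_nsmul _ _ _ fun a _ => ?_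
  rw [← Finset.card_image_of_injOn (f := Prod.snd)]
  · refine card_filter_gap_le V _ a s hs fun b hb => ?_
    obtain ⟨⟨x, y⟩, hf, rfl⟩ := Finset.mem_image.1 hb
    obtain ⟨hfF, rfl⟩ := Finset.mem_filter.1 hf
    exact (hF _ hfF).2
  · rintro ⟨x, y⟩ hf ⟨x', y'⟩ hf' h
    simp only [Finset.coe_filter, Set.mem_ofPred_eq] at hf hf' h
    simp [hf.2, hf'.2, h]

theorem two_mul_card_le_of_lt (W : Finset α) (F : Finset (α × α))
    (hF : ∀ f ∈ F, f.1 ∈ W ∧ f.2 ∈ W ∧ f.1 < f.2) :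
    2 * F.card ≤ W.card * (W.card - 1) := by
  have hdisj : Disjoint F (F.image Prod.swap) := by
    refine Finset.disjoint_left.2 fun f hf hf' => ?_
    obtain ⟨g, hg, rfl⟩ := Finset.mem_image.1 hf'
    exact lt_asymm (hF _ hf).2.2 (hF g hg).2.2
  have hsub : F ∪ F.image Prod.swap ⊆ W.offDiag := by
    intro f hf
    rcases Finset.mem_union.1 hf with h | h
    · exact Finset.mem_offDiag.2 ⟨(hF f h).1, (hF f h).2.1, (hF f h).2.2.ne⟩
    · obtain ⟨g, hg, rfl⟩ := Finset.mem_image.1 h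
      exact Finset.mem_offDiag.2 ⟨(hF g hg).2.1, (hF g hg).1, (hF g hg).2.2.ne'⟩
  have h := Finset.card_le_card hsub
  rw [Finset.card_union_of_disjoint hdisj, Finset.card_image_of_injective _ Prod.swap_injective,
    Finset.offDiag_card, ← Nat.mul_sub_one] at h
  omega

theorem gap_lt_gap (V : Finset α) {e f : α × α} (he : e.1 < e.2) (he₂ : e.2 ∈ V) (hf₁ : f.1 ∈ V)
    (h₁ : e.1 ≤ f.1) (h₂ : f.2 ≤ e.2) (h : f.1 < f.2) (hne : e.1 < f.1 ∨ f.2 < e.2) :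
    gap V f < gap V e := by
  refine Finset.card_lt_card (Finset.ssubset_iff_of_subset ?_ |>.2 ?_)
  · intro x hx
    simp only [Finset.mem_filter] at hx ⊢
    exact ⟨hx.1, h₁.trans_lt hx.2.1, hx.2.2.trans h₂⟩
  · rcases hne with hne | hne
    · exact ⟨f.1, by simp [hf₁, hne, h.le.trans h₂]⟩
    · exact ⟨e.2, by simp [he₂, he, hne]⟩

theorem sq_add_le_of_bounds {s D N : ℝ} (hs : 40 ≤ s) (hD : s < D) (h₁ : N ≤ s * D)
    (h₂ : 2 * N ≤ (D + 1) * D) : s ^ 2 + N ≤ 17 / 10 * s * (D - 1) := by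
  rcases le_total (3 / 2 * s) D with h | h
  · nlinarith
  · nlinarith [mul_nonneg (sub_nonneg.2 hD.le) (sub_nonneg.2 h)]

theorem card_le_of_interleaving_le (k : ℕ) (hk : 1600 ≤ k) (V : Finset α) (E : Finset (α × α))
    (hE : ∀ e ∈ E, e.1 ∈ V ∧ e.2 ∈ V ∧ e.1 < e.2)
    (hcr : ∀ e ∈ E, (interleaving E e).card ≤ k) :
    (E.card : ℝ) ≤ 17 / 10 * Real.sqrt k * V.card := by
  induction hn : V.card using Nat.strong_induction_on generalizing V E with
  | _ n ih =>
  subst hn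
  set s := Real.sqrt k with hs_def
  have hs : 40 ≤ s := Real.le_sqrt_of_sq_le (by norm_num; exact_mod_cast hk)
  have hsq : s ^ 2 = k := Real.sq_sqrt (Nat.cast_nonneg k)
  by_cases hlong : ∀ e ∈ E, (gap V e : ℝ) ≤ s
  · have h := card_le_mul_of_gap_le V V E s (by linarith) fun f hf =>
      ⟨(hE f hf).1, (hE f hf).2.1, (hE f hf).2.2, hlong f hf⟩
    have : 0 ≤ s * V.card := by positivity
    linarith
  push Not at hlong
  obtain ⟨e₀, he₀, hlong₀⟩ := hlong
  obtain ⟨e, he, hmin⟩ := Finset.exists_min_image (E.filter fun e => s < (gap V e : ℝ)) (gap V)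
    ⟨e₀, Finset.mem_filter.2 ⟨he₀, hlong₀⟩⟩
  obtain ⟨heE, hes⟩ := Finset.mem_filter.1 he
  obtain ⟨he₁, he₂, he₁₂⟩ := hE e heE
  set D := gap V e with hD
  set S := V.filter fun x => e.1 < x ∧ x < e.2 with hS
  set E' := E.filter fun f => ¬(f.1 ∈ S ∨ f.2 ∈ S) with hE'
  set F := E.filter fun f => (f.1 ∈ S ∨ f.2 ∈ S) ∧ e.1 ≤ f.1 ∧ f.2 ≤ e.2 with hF
  have hScard : S.card + 1 = D := by
    rw [hD, gap, ← Finset.card_insert_of_notMem (a := e.2) (s := S) (by simp [hS])]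
    congr 1
    ext x
    simp only [hS, Finset.mem_insert, Finset.mem_filter, le_iff_lt_or_eq]
    constructor
    · rintro (rfl | h)
      · exact ⟨he₂, he₁₂, Or.inr rfl⟩
      · exact ⟨h.1, h.2.1, Or.inl h.2.2⟩
    · rintro ⟨h, h', h'' | h''⟩
      · exact Or.inr ⟨h, h', h''⟩
      · exact Or.inl h''
  have hSV : S ⊆ V := Finset.filter_subset _ _
  have hVcard : (V \ S).card + S.card = V.card := Finset.card_sdiff_add_card_eq_card hSV
  have hSpos : 0 < S.card := by
    have : (1 : ℝ) < D := by linarith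
    have : 1 < D := by exact_mod_cast this
    omega
  have hEcard : E.card ≤ E'.card + (interleaving E e).card + F.card := by
    have : E ⊆ E' ∪ interleaving E e ∪ F := by
      intro f hf
      obtain ⟨hf₁, hf₂, hf₁₂⟩ := hE f hf
      simp only [hE', hF, hS, interleaving, Finset.mem_union, Finset.mem_filter, hf, hf₁, hf₂,
        true_and]
      grind
    exact (Finset.card_le_card this).trans
      ((Finset.card_union_le _ _).trans (Nat.add_le_add_right (Finset.card_union_le _ _) _))
  have hIH : (E'.card : ℝ) ≤ 17 / 10 * s * (V \ S).card := by
    refine ih _ (by omega) (V \ S) E' (fun f hf => ?_) (fun f hf => ?_) rfl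
    · obtain ⟨hfE, hfS⟩ := Finset.mem_filter.1 hf
      obtain ⟨hf₁, hf₂, hf₁₂⟩ := hE f hfE
      push Not at hfS
      exact ⟨Finset.mem_sdiff.2 ⟨hf₁, hfS.1⟩, Finset.mem_sdiff.2 ⟨hf₂, hfS.2⟩, hf₁₂⟩
    · exact (Finset.card_le_card (Finset.filter_subset_filter _ (Finset.filter_subset _ _))).trans
        (hcr f (Finset.mem_of_mem_filter f hf))
  have hFmem : ∀ f ∈ F, f ∈ E ∧ (e.1 < f.1 ∨ f.2 < e.2) ∧ e.1 ≤ f.1 ∧ f.2 ≤ e.2 := by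
    intro f hf
    obtain ⟨hfE, hfS, h⟩ := Finset.mem_filter.1 hf
    refine ⟨hfE, ?_, h⟩
    simp only [hS, Finset.mem_filter] at hfS
    tauto
  have hF₁ : (F.card : ℝ) ≤ s * D := by
    have hcard : (insert e.1 S).card = D := by
      rw [Finset.card_insert_of_notMem (by simp [hS]), hScard]
    rw [← hcard]
    refine card_le_mul_of_gap_le V _ F s (by linarith) fun f hf => ?_
    obtain ⟨hfE, hne, h₁, h₂⟩ := hFmem f hf
    obtain ⟨hf₁, hf₂, hf₁₂⟩ := hE f hfE
    refine ⟨?_, hf₂, hf₁₂, ?_⟩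
    · rcases h₁.eq_or_lt with h | h
      · exact Finset.mem_insert.2 (Or.inl h.symm)
      · exact Finset.mem_insert_of_mem (Finset.mem_filter.2 ⟨hf₁, h, hf₁₂.trans_le h₂⟩)
    · by_contra! hlt
      exact (gap_lt_gap V he₁₂ he₂ hf₁ h₁ h₂ hf₁₂ hne).not_ge
        (hmin f (Finset.mem_filter.2 ⟨hfE, hlt⟩))
  have hF₂ : 2 * (F.card : ℝ) ≤ ((D : ℝ) + 1) * D := by
    have hcard : (insert e.1 (V.filter fun x => e.1 < x ∧ x ≤ e.2)).card = D + 1 :=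
      Finset.card_insert_of_notMem (by simp)
    have h := two_mul_card_le_of_lt (insert e.1 (V.filter fun x => e.1 < x ∧ x ≤ e.2)) F
      fun f hf => ?_
    · rw [hcard, Nat.add_sub_cancel] at h
      exact_mod_cast h
    · obtain ⟨hfE, hne, h₁, h₂⟩ := hFmem f hf
      obtain ⟨hf₁, hf₂, hf₁₂⟩ := hE f hfE
      refine ⟨?_, ?_, hf₁₂⟩
      · rcases h₁.eq_or_lt with h | h
        · exact Finset.mem_insert.2 (Or.inl h.symm)
        · exact Finset.mem_insert_of_mem (Finset.mem_filter.2 ⟨hf₁, h, hf₁₂.le.trans h₂⟩)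
      · exact Finset.mem_insert_of_mem (Finset.mem_filter.2 ⟨hf₂, h₁.trans_lt hf₁₂, h₂⟩)
  have key := sq_add_le_of_bounds hs hes hF₁ hF₂
  have h₁ : (E.card : ℝ) ≤ E'.card + k + F.card := by
    exact_mod_cast hEcard.trans (by gcongr; exact hcr e heE)
  have h₂ : ((V \ S).card : ℝ) + S.card = V.card := by exact_mod_cast hVcard
  have h₃ : (S.card : ℝ) + 1 = D := by exact_mod_cast hScard
  rw [← h₂, mul_add, show (S.card : ℝ) = D - 1 by linarith]
  linarith

end Combinatorics

section Geometry

/-- Twice the signed area of the triangle `a b c`. -/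
noncomputable def orient (a b c : Pt) : ℝ :=
  (b 0 - a 0) * (c 1 - a 1) - (b 1 - a 1) * (c 0 - a 0)

theorem openSegment_inter_nonempty_of_orient_pos {a b c d : Pt} (h₁ : 0 < orient a b c)
    (h₂ : 0 < orient a b d) (h₃ : 0 < orient a c d) (h₄ : 0 < orient b c d) :
    (openSegment ℝ a c ∩ openSegment ℝ b d).Nonempty := by
  have hsum : orient b c d + orient a b d = orient a c d + orient a b c := by
    simp only [orient]; ring
  have hpos : 0 < orient b c d + orient a b d := by positivity
  refine ⟨(orient b c d / (orient b c d + orient a b d)) • a +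
    (orient a b d / (orient b c d + orient a b d)) • c,
    ⟨_, _, by positivity, by positivity, by field_simp, rfl⟩,
    ⟨orient a c d / (orient b c d + orient a b d), orient a b c / (orient b c d + orient a b d),
      by positivity, by positivity, by rw [← add_div, ← hsum, div_self hpos.ne'], ?_⟩⟩
  ext i
  fin_cases i <;> simp <;> field_simp <;> simp only [orient] <;> ring

theorem ConvexPos.not_convex_combination {V : Finset Pt} (hV : ConvexPos V) {p a b c : Pt}
    (hp : p ∈ V) (ha : a ∈ V.erase p) (hb : b ∈ V.erase p) (hc : c ∈ V.erase p) {s t u : ℝ}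
    (hs : 0 ≤ s) (ht : 0 ≤ t) (hu : 0 ≤ u) (hpos : 0 < s + t + u) :
    ¬∀ i, (s + t + u) * p i = s * a i + t * b i + u * c i := by
  intro h
  refine hV p hp ?_
  have hmem : ∑ i, ![s / (s + t + u), t / (s + t + u), u / (s + t + u)] i • ![a, b, c] i ∈
      convexHull ℝ ((V.erase p : Finset Pt) : Set Pt) := by
    refine (convex_convexHull ℝ _).sum_mem (fun i _ => ?_) ?_ fun i _ => subset_convexHull ℝ _ ?_
    · fin_cases i <;> simp <;> positivity
    · simp only [Fin.sum_univ_three, Matrix.cons_val]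
      rw [← add_div, ← add_div, div_self hpos.ne']
    · fin_cases i
      exacts [ha, hb, hc]
  convert hmem using 1
  ext i
  have := h i
  simp only [Fin.sum_univ_three, Matrix.cons_val, PiLp.add_apply, PiLp.smul_apply, smul_eq_mul]
  field_simp
  linarith

theorem ConvexPos.not_same_ray {V : Finset Pt} (hV : ConvexPos V) {p a b : Pt} (hp : p ∈ V)
    (ha : a ∈ V) (hb : b ∈ V) (hap : a ≠ p) (hbp : b ≠ p) (hab : a ≠ b) {s t : ℝ} (hs : 0 < s)
    (ht : 0 < t) : ¬∀ i, t * (a i - p i) = s * (b i - p i) := by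
  intro h
  rcases le_total s t with hst | hst
  · refine hV.not_convex_combination ha (a := p) (b := b) (c := b) (s := t - s) (t := s) (u := 0)
      (by simp [hp, hap.symm]) (by simp [hb, hab.symm]) (by simp [hb, hab.symm]) (by linarith)
      hs.le le_rfl (by linarith) fun i => ?_
    linarith [h i]
  · refine hV.not_convex_combination hb (a := p) (b := a) (c := a) (s := s - t) (t := t) (u := 0)
      (by simp [hp, hbp.symm]) (by simp [ha, hab]) (by simp [ha, hab]) (by linarith)
      ht.le le_rfl (by linarith) fun i => ?_
    linarith [h i]

/-- `a` comes strictly after `p` in the lexicographic order of the coordinates. -/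
def LexBelow (p a : Pt) : Prop :=
  p 0 < a 0 ∨ p 0 = a 0 ∧ p 1 < a 1

theorem exists_lexBelow {V : Finset Pt} (hV : V.Nonempty) :
    ∃ p ∈ V, ∀ a ∈ V, a ≠ p → LexBelow p a := by
  obtain ⟨p, hp, hmin⟩ := V.exists_min_image (fun q : Pt => toLex (q 0, q 1)) hV
  refine ⟨p, hp, fun a ha hne => ?_⟩
  rcases Prod.Lex.toLex_le_toLex.1 (hmin a ha) with h | ⟨h, h'⟩
  · exact Or.inl h
  · refine Or.inr ⟨h, lt_of_le_of_ne h' fun h'' => hne ?_⟩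
    ext i
    fin_cases i
    exacts [h.symm, h''.symm]

theorem orient_trans {p a b c : Pt} (ha : LexBelow p a) (hb : LexBelow p b) (hc : LexBelow p c)
    (hab : 0 < orient p a b) (hbc : 0 < orient p b c) : 0 < orient p a c := by
  have hx : orient p a c * (b 0 - p 0) =
      orient p a b * (c 0 - p 0) + orient p b c * (a 0 - p 0) := by
    simp only [orient]; ring
  have ha₀ : 0 ≤ a 0 - p 0 := by rcases ha with h | h <;> linarith [h]
  have hc₀ : 0 ≤ c 0 - p 0 := by rcases hc with h | h <;> linarith [h]
  rcases hb with hb | ⟨hb, hb'⟩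
  · rcases ha with ha | ⟨ha, ha'⟩
    · refine pos_of_mul_pos_left (b := b 0 - p 0) ?_ (by linarith)
      rw [hx]
      have := mul_pos hbc (sub_pos.2 ha)
      have := mul_nonneg hab.le hc₀
      linarith
    · have := mul_pos (sub_pos.2 ha') (sub_pos.2 hb)
      simp only [orient, ← ha] at hab
      linarith
  · have := mul_nonneg (sub_pos.2 hb').le hc₀
    simp only [orient, ← hb] at hbc
    linarith

theorem ConvexPos.orient_ne_zero {V : Finset Pt} (hV : ConvexPos V) {p a b : Pt} (hp : p ∈ V)
    (ha : a ∈ V) (hb : b ∈ V) (hap : a ≠ p) (hbp : b ≠ p) (hab : a ≠ b) (hpa : LexBelow p a)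
    (hpb : LexBelow p b) : orient p a b ≠ 0 := by
  intro h
  simp only [orient] at h
  rcases hpa with hpa | ⟨hpa, hpa'⟩
  · rcases hpb with hpb | ⟨hpb, hpb'⟩
    · refine hV.not_same_ray hp ha hb hap hbp hab (sub_pos.2 hpa) (sub_pos.2 hpb) fun i => ?_
      fin_cases i
      · simp; ring
      · simp; linarith
    · have := mul_pos (sub_pos.2 hpa) (sub_pos.2 hpb')
      simp only [← hpb] at h
      linarith
  · rcases hpb with hpb | ⟨hpb, hpb'⟩
    · have := mul_pos (sub_pos.2 hpa') (sub_pos.2 hpb)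
      simp only [← hpa] at h
      linarith
    · refine hV.not_same_ray hp ha hb hap hbp hab (sub_pos.2 hpa') (sub_pos.2 hpb') fun i => ?_
      fin_cases i
      · simp [← hpa, ← hpb]
      · simp; ring

theorem ConvexPos.orient_pos_of_fan {V : Finset Pt} (hV : ConvexPos V) {p a b c : Pt} (hp : p ∈ V)
    (ha : a ∈ V) (hb : b ∈ V) (hc : c ∈ V) (hab : 0 < orient p a b) (hbc : 0 < orient p b c) :
    0 < orient a b c := by
  by_contra! h
  have hpb : p ≠ b := by rintro rfl; simp [orient] at hbc
  have hba : a ≠ b := by rintro rfl; simp [orient, mul_comm] at hab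
  have hcb : c ≠ b := by rintro rfl; simp [orient, mul_comm] at hbc
  refine hV.not_convex_combination hb (a := p) (b := a) (c := c) (s := -orient a b c)
    (t := orient p b c) (u := orient p a b) (by simp [*]) (by simp [*]) (by simp [*])
    (by linarith) hbc.le hab.le (by linarith) fun i => ?_
  fin_cases i <;> simp [orient] <;> ring

/-- Points in convex position can be listed in counterclockwise order. -/
theorem ConvexPos.exists_enumeration {V : Finset Pt} (hV : ConvexPos V) :
    ∃ f : Fin V.card → Pt, Function.Injective f ∧ (∀ p ∈ V, ∃ i, f i = p) ∧
      ∀ i j l, i < j → j < l → 0 < orient (f i) (f j) (f l) := by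
  rcases V.eq_empty_or_nonempty with rfl | hne
  · exact ⟨fun _ => 0, fun i => i.elim0, by simp, fun i => i.elim0⟩
  obtain ⟨p, hp, hlex⟩ := exists_lexBelow hne
  have hself : ∀ a, orient p a a = 0 := fun a => by simp only [orient]; ring
  have hleft : ∀ a, orient p p a = 0 := fun a => by simp only [orient]; ring
  have hright : ∀ a, orient p a p = 0 := fun a => by simp only [orient]; ring
  have hswap : ∀ a b, orient p b a = -orient p a b := fun a b => by simp only [orient]; ring
  have hleft' : ∀ {a b}, 0 < orient p a b → a ≠ p := by
    rintro a b h rfl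
    exact h.ne' (hleft b)
  have hright' : ∀ {a b}, 0 < orient p a b → b ≠ p := by
    rintro a b h rfl
    exact h.ne' (hright a)
  let r : V → V → Prop := fun a b => (a.1 = p ∧ b.1 ≠ p) ∨ 0 < orient p a b
  have hirrefl : ∀ a, ¬r a a := by
    rintro a (h | h)
    · exact h.2 h.1
    · exact h.ne' (hself a)
  have hrtrans : ∀ a b c, r a b → r b c → r a c := by
    rintro a b c (hab | hab) (hbc | hbc)
    · exact absurd hbc.1 hab.2
    · exact Or.inl ⟨hab.1, hright' hbc⟩
    · exact absurd hbc.1 (hright' hab)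
    · exact Or.inr (orient_trans (hlex a a.2 (hleft' hab)) (hlex b b.2 (hleft' hbc))
        (hlex c c.2 (hright' hbc)) hab hbc)
  have htri : ∀ a b, ¬r a b → ¬r b a → a = b := by
    intro a b hab hba
    by_contra hne
    have hne' : a.1 ≠ b.1 := fun h => hne (Subtype.ext h)
    by_cases ha : a.1 = p
    · exact hab (Or.inl ⟨ha, fun hb => hne' (ha.trans hb.symm)⟩)
    by_cases hb : b.1 = p
    · exact hba (Or.inl ⟨hb, ha⟩)
    rcases (hV.orient_ne_zero hp a.2 b.2 ha hb hne' (hlex a a.2 ha) (hlex b b.2 hb)).lt_or_gt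
      with h | h
    · exact hba (Or.inr (by rw [hswap]; linarith))
    · exact hab (Or.inr h)
  have : IsStrictTotalOrder V r :=
    { trichotomous := htri, irrefl := hirrefl, trans := hrtrans }
  let _ : LinearOrder V := linearOrderOfSTO r
  let g : Fin V.card ≃o V := Fintype.orderIsoFinOfCardEq V (by simp)
  refine ⟨fun i => g i, Subtype.val_injective.comp g.injective,
    fun q hq => ⟨g.symm ⟨q, hq⟩, by simp⟩, fun i j l hij hjl => ?_⟩
  have hij' : r (g i) (g j) := g.lt_iff_lt.2 hij
  have hjl' : r (g j) (g l) := g.lt_iff_lt.2 hjl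
  rcases hjl' with hjl' | hjl'
  · rcases hij' with hij' | hij'
    · exact absurd hjl'.1 hij'.2
    · exact absurd hjl'.1 (hright' hij')
  · rcases hij' with hij' | hij'
    · simpa only [hij'.1] using hjl'
    · exact hV.orient_pos_of_fan hp (g i).2 (g j).2 (g l).2 hij' hjl'

end Geometry

theorem OuterKPlanar.card_le {G : ConvexGeomGraph} {k : ℕ} (hG : OuterKPlanar G k)
    (hk : 1600 ≤ k) : (G.E.card : ℝ) ≤ 17 / 10 * Real.sqrt k * G.V.card := by
  obtain ⟨f, hinj, hsurj, hor⟩ := G.convexPos.exists_enumeration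
  let φ : Fin G.V.card × Fin G.V.card → Sym2 Pt := fun e => s(f e.1, f e.2)
  let E : Finset (Fin G.V.card × Fin G.V.card) :=
    Finset.univ.filter fun e => e.1 < e.2 ∧ φ e ∈ G.E
  have hE : ∀ e ∈ E, e.1 < e.2 ∧ φ e ∈ G.E := fun e he => (Finset.mem_filter.1 he).2
  have hφ : Set.InjOn φ E := by
    rintro ⟨a, b⟩ he ⟨c, d⟩ he' h
    have h₁ := (hE _ he).1
    have h₂ := (hE _ he').1
    simp only [φ, Sym2.eq_iff, hinj.eq_iff] at h
    rcases h with ⟨rfl, rfl⟩ | ⟨rfl, rfl⟩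
    · rfl
    · exact absurd h₁ h₂.asymm
  have hcard : G.E.card ≤ E.card := by
    refine (Finset.card_le_card (t := E.image φ) fun e he => ?_).trans Finset.card_image_le
    induction e using Sym2.ind with
    | _ x y =>
    obtain ⟨i, rfl⟩ := hsurj x (G.mem_V _ he x (Sym2.mem_mk_left x y))
    obtain ⟨j, rfl⟩ := hsurj y (G.mem_V _ he y (Sym2.mem_mk_right _ y))
    rcases lt_trichotomy i j with h | rfl | h
    · exact Finset.mem_image.2 ⟨(i, j), by simp [E, φ, h, he], rfl⟩
    · exact absurd rfl (G.not_diag _ he)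
    · exact Finset.mem_image.2 ⟨(j, i), by simp [E, φ, h, Sym2.eq_swap, he], Sym2.eq_swap⟩
  have hcross : ∀ a b c d, a < b → b < c → c < d →
      (openSegment ℝ (f a) (f c) ∩ openSegment ℝ (f b) (f d)).Nonempty :=
    fun a b c d hab hbc hcd => openSegment_inter_nonempty_of_orient_pos
      (hor a b c hab hbc) (hor a b d hab (hbc.trans hcd)) (hor a c d (hab.trans hbc) hcd)
      (hor b c d hbc hcd)
  have hmain := card_le_of_interleaving_le k hk Finset.univ E
    (fun e he => ⟨Finset.mem_univ _, Finset.mem_univ _, (hE e he).1⟩) fun e he => ?_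
  · rw [Finset.card_univ, Fintype.card_fin] at hmain
    exact (Nat.cast_le.2 hcard).trans hmain
  · refine le_trans ?_ (hG (φ e) (hE e he).2)
    refine Finset.card_le_card_of_injOn φ (fun g hg => ?_) (hφ.mono fun g hg => ?_)
    · obtain ⟨hgE, hg⟩ := Finset.mem_filter.1 hg
      refine Finset.mem_filter.2 ⟨(hE g hgE).2, fun heq => ?_, ?_⟩
      · obtain rfl := hφ he hgE heq
        rcases hg with hg | hg
        · exact lt_irrefl _ hg.1
        · exact lt_irrefl _ hg.1
      · rcases hg with hg | hg
        · exact hcross _ _ _ _ hg.1 hg.2.1 hg.2.2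
        · rw [Set.inter_comm]
          exact hcross _ _ _ _ hg.1 hg.2.1 hg.2.2
    · exact (Finset.mem_filter.1 hg).1

/-- there is K such that for all k ≥ K every bipartite outer
k-planar graph on n vertices has at most 2·√(8/11)·√k·n edges. -/
theorem stmt18 :
    ∃ K : ℕ, ∀ k : ℕ, K ≤ k → ∀ G : ConvexGeomGraph, OuterKPlanar G k →
      Bipartite G →
      (G.E.card : ℝ) ≤ 2 * Real.sqrt (8 / 11) * Real.sqrt k * G.V.card := by
  refine ⟨1600, fun k hk G hG _ => (hG.card_le hk).trans ?_⟩
  have h : 17 / 20 ≤ Real.sqrt (8 / 11) := Real.le_sqrt_of_sq_le (by norm_num)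
  gcongr
  linarith
end
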